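/- arXiv:2003.05412 — 2 statements merged into one kernel-verified Lean document; each statement's English description precedes it below -/
import Mathlib

section
/- Suppose: (a) H_Θ is a self-adjoint operator in 𝔉 such that Z_{Σ,Θ} ≠ ∅ and, for every z ∈ Z_{Σ,Θ}, z ∈ ϱ(H_Θ) and (−H_Θ + z)⁻¹ = R_z + G_z(Θ + M_z)⁻¹G*_{z̄}; (b) Σ_n : dom(Σ_n) ⊆ 𝔉 → 𝔛 (n ∈ ℕ) are densely defined closable operators with 𝔥₁ ⊆ dom(Σ_n) and Σ_n|𝔥₁ ∈ B(𝔥₁,𝔛); (c) Θ_n : dom(Θ_n) ⊆ 𝔛 → 𝔛 are self-adjoint with dom(Θ_n) ⊇ dom(Θ) and 0 ∈ ϱ(Θ_n); (d) for each n, the map φ ↦ Σ_nRΣ_n*φ, defined for φ ∈ dom(Σ_n*), extends to a bounded operator Σ_nRΣ_n* ∈ B(𝔛) (and then Σ_nR_zΣ_n* := Σ_nRΣ_n* + (λ₀ − z)(Σ_nR)(Σ_nR_{z̄})* ∈ B(𝔛) for every z ∈ ϱ(H)); (e) H_n := H + Σ_n*Θ_n⁻¹Σ_n is self-adjoint with dom(H_n)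 = 𝔥₁ and (−H_n + z)⁻¹ = R_z + (Σ_nR_{z̄})*(Θ_n − Σ_nR_zΣ_n*)⁻¹Σ_nR_z for all z ∈ ϱ(H) ∩ ϱ(H_n). If ‖Σ_n − Σ‖_{B(𝔥₁,𝔛)} → 0, ‖(Θ_n − Σ_nRΣ_n*) − Θ‖_{B(dom(Θ),𝔛)} → 0 (dom(Θ) equipped with its graph norm), and either dom(Θ_n) = dom(Θ) for all n or there exists a complex conjugate pair z_± ∈ ℂ_± such that sup_n ‖(Θ_n − Σ_nR_{z_±}Σ_n*)⁻¹φ‖_𝔛 < ∞ for every φ ∈ 𝔛, then H_n converges to H_Θ in norm-resolvent sense, i.e. ‖(−H_n + z)⁻¹ − (−H_Θ + z)⁻¹‖_{B(𝔉)} → 0 for every z ∈ ℂ ∖ ℝ. -/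
noncomputable section

open scoped ComplexInnerProductSpace
open ContinuousLinearMap Filter

variable {F X : Type*}
  [NormedAddCommGroup F] [InnerProductSpace ℂ F] [CompleteSpace F]
  [NormedAddCommGroup X] [InnerProductSpace ℂ X] [CompleteSpace X]

/-- `W R l z = 1 + (z - l) • R`; the point `z` belongs to the resolvent set of the
self-adjoint operator `H` iff `W R l z` is boundedly invertible, where
`R = (-H + λ₀)⁻¹` and `l = λ₀ ∈ ϱ(H) ∩ ℝ` encode `H`. -/
def W (R : F →L[ℂ] F) (l : ℝ) (z : ℂ) : F →L[ℂ] F := 1 + (z - (l : ℂ)) • R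

/-- The resolvent set `ϱ(H)` of `H`, encoded through `R = (-H + λ₀)⁻¹`. -/
def res (R : F →L[ℂ] F) (l : ℝ) : Set ℂ := {z | IsUnit (W R l z)}

/-- The resolvent `R_z = (-H + z)⁻¹`. -/
def Rz (R : F →L[ℂ] F) (l : ℝ) (z : ℂ) : F →L[ℂ] F := R ∘L Ring.inverse (W R l z)

/-- `G_z = (Σ R_z̄)*`, where the bounded operator `B = Σ ∘ R : 𝔉 →L 𝔛` encodes the
(graph-norm bounded) operator `Σ : 𝔥₁ → 𝔛`. -/
def Gz (R : F →L[ℂ] F) (B : F →L[ℂ] X) (l : ℝ) (z : ℂ) : X →L[ℂ] F :=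
  adjoint (B ∘L Ring.inverse (W R l (starRingEnd ℂ z)))

/-- `(-H + λ₀) ψ`, for `ψ ∈ dom H = ran R`. -/
def Hinv (R : F →L[ℂ] F) (ψ : F) : F := Function.invFun (⇑R) ψ

/-- `Σ ψ`, for `ψ ∈ dom H = ran R`. -/
def SigmaOf (R : F →L[ℂ] F) (B : F →L[ℂ] X) (ψ : F) : X := B (Hinv R ψ)

/-- `Q` is the resolvent `(-K + z)⁻¹` of the (in general unbounded) operator `K`. -/
def IsResolventAt (K : F →ₗ.[ℂ] F) (z : ℂ) (Q : F →L[ℂ] F) : Prop :=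
  (∀ ψ : F, Q ψ ∈ K.domain) ∧
  (∀ (ψ : F) (h : Q ψ ∈ K.domain), z • Q ψ - K ⟨Q ψ, h⟩ = ψ) ∧
  (∀ ψ : K.domain, Q (z • (ψ : F) - K ψ) = (ψ : F))

/-- The resolvent set of the (in general unbounded) operator `K`. -/
def pres (K : F →ₗ.[ℂ] F) : Set ℂ := {z | ∃ Q : F →L[ℂ] F, IsResolventAt K z Q}

/-- `J ∈ B(𝔛)` is a two-sided bounded inverse of `Θ + M` (with domain `dom Θ`). -/
def IsBoundedInvOf (Θ : X →ₗ.[ℂ] X) (M : X → X) (J : X →L[ℂ] X) : Prop :=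
  (∀ y : X, J y ∈ Θ.domain) ∧
  (∀ (y : X) (h : J y ∈ Θ.domain), Θ ⟨J y, h⟩ + M (J y) = y) ∧
  (∀ x : Θ.domain, J (Θ x + M (x : X)) = (x : X))

/-- The set `Z_{Σ,Θ} = {z ∈ ϱ(H) : Θ + M_z` has a bounded inverse in `B(𝔛)}`,
where `M_z = Σ (G - G_z)`. -/
def ZSet (R : F →L[ℂ] F) (B : F →L[ℂ] X) (l : ℝ) (Θ : X →ₗ.[ℂ] X) : Set ℂ :=
  {z | z ∈ res R l ∧ ∃ J : X →L[ℂ] X,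
    IsBoundedInvOf Θ (fun x => SigmaOf R B ((Gz R B l l - Gz R B l z) x)) J}

/-- `K ∈ B(𝔛)` is a two-sided bounded inverse of `Θ' - S` (with domain `dom Θ'`),
for a bounded operator `S`. -/
def IsBddInvOn (Θ' : X →ₗ.[ℂ] X) (S : X →L[ℂ] X) (K : X →L[ℂ] X) : Prop :=
  (∀ y : X, K y ∈ Θ'.domain) ∧
  (∀ (y : X) (h : K y ∈ Θ'.domain), Θ' ⟨K y, h⟩ - S (K y) = y) ∧
  (∀ x : Θ'.domain, K (Θ' x - S (x : X)) = (x : X))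

/-- The bounded operator `Σₙ R_z Σₙ* = Σₙ R Σₙ* + (λ₀ - z)(Σₙ R)(Σₙ R_z̄)*`, where
`En` extends `Σₙ R Σₙ*` and `Bn = Σₙ R`. -/
def SRS (R : F →L[ℂ] F) (Bn : F →L[ℂ] X) (En : X →L[ℂ] X) (l : ℝ) (z : ℂ) :
    X →L[ℂ] X :=
  En + ((l : ℂ) - z) • (Bn ∘L Gz R Bn l z)

section Resolvent

lemma IsResolventAt.one_add_mul_one_add {K : F →ₗ.[ℂ] F} {w z : ℂ} {P Q : F →L[ℂ] F}
    (hP : IsResolventAt K w P) (hQ : IsResolventAt K z Q) :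
    (1 + (z - w) • P) * (1 + (w - z) • Q) = 1 := by
  ext ψ
  have h1 := hQ.2.1 ψ (hQ.1 ψ)
  have h2 := hP.2.2 ⟨Q ψ, hQ.1 ψ⟩
  have h3 : w • Q ψ - K ⟨Q ψ, hQ.1 ψ⟩ = ψ + (w - z) • Q ψ := by
    refine Eq.trans ?_ (congrArg (· + (w - z) • Q ψ) h1)
    module
  simp only at h2
  rw [h3] at h2
  change (ψ + (w - z) • Q ψ) + (z - w) • P (ψ + (w - z) • Q ψ) = ψ
  rw [h2]
  module

lemma IsResolventAt.eq {K : F →ₗ.[ℂ] F} {z : ℂ} {P Q : F →L[ℂ] F}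
    (hP : IsResolventAt K z P) (hQ : IsResolventAt K z Q) : P = Q := by
  ext ψ
  have h1 := hQ.2.1 ψ (hQ.1 ψ)
  have h2 := hP.2.2 ⟨Q ψ, hQ.1 ψ⟩
  simp only at h2
  rwa [h1] at h2

lemma IsResolventAt.inverse_one_add {K : F →ₗ.[ℂ] F} {w z : ℂ} {P Q : F →L[ℂ] F}
    (hP : IsResolventAt K w P) (hQ : IsResolventAt K z Q) :
    Ring.inverse (1 + (z - w) • P) = 1 + (w - z) • Q :=
  Ring.inverse_unit ⟨_, _, hP.one_add_mul_one_add hQ, hQ.one_add_mul_one_add hP⟩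

/-- Norm-resolvent convergence at one point implies it at every other common point. -/
lemma IsResolventAt.tendsto_of_tendsto {K : F →ₗ.[ℂ] F} {Kn : ℕ → F →ₗ.[ℂ] F} {w z : ℂ}
    {P Q : F →L[ℂ] F} {Pn Qn : ℕ → F →L[ℂ] F}
    (hP : IsResolventAt K w P) (hQ : IsResolventAt K z Q)
    (hPn : ∀ n, IsResolventAt (Kn n) w (Pn n)) (hQn : ∀ n, IsResolventAt (Kn n) z (Qn n))
    (h : Tendsto Pn atTop (nhds P)) : Tendsto Qn atTop (nhds Q) := by
  rcases eq_or_ne w z with rfl | hwz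
  · rw [← hP.eq hQ]
    exact h.congr fun n => (hPn n).eq (hQn n)
  have hu : IsUnit (1 + (z - w) • P) :=
    isUnit_iff_exists.mpr
      ⟨_, hP.one_add_mul_one_add hQ, hQ.one_add_mul_one_add hP⟩
  have h1 : Tendsto (fun n => 1 + (z - w) • Pn n) atTop (nhds (1 + (z - w) • P)) :=
    (h.const_smul _).const_add _
  have h2 := (NormedRing.inverse_continuousAt hu.unit).tendsto.comp h1
  rw [IsUnit.unit_spec, hP.inverse_one_add hQ] at h2
  have h3 := (h2.sub_const 1).const_smul (w - z)⁻¹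
  have hne : w - z ≠ 0 := sub_ne_zero.mpr hwz
  refine (h3.congr fun n => ?_).trans_eq ?_
  · simp [(hPn n).inverse_one_add (hQn n), smul_smul, hne]
  · simp [smul_smul, hne]

/-- Nonreal points belong to the resolvent set of a self-adjoint operator. -/
lemma mem_pres_of_isSelfAdjoint {K : F →ₗ.[ℂ] F} (hK : IsSelfAdjoint K) {z : ℂ}
    (hz : z.im ≠ 0) : z ∈ pres K := by
  have hd := hK.dense_domain
  have hsa : K.adjoint = K := LinearPMap.isSelfAdjoint_def.mp hK
  have hsymm : ∀ x y : K.domain, inner ℂ (K x) (y : F) = inner ℂ (x : F) (K y) := by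
    have := LinearPMap.adjoint_isFormalAdjoint hd
    rw [hsa] at this
    exact this
  have hbound : ∀ (w : ℂ) (x : K.domain), |w.im| * ‖(x : F)‖ ≤ ‖w • (x : F) - K x‖ := by
    intro w x
    have him : (inner ℂ (x : F) (K x)).im = 0 := by
      rw [← Complex.conj_eq_iff_im, inner_conj_symm]
      exact hsymm x x
    have h1 : (inner ℂ (x : F) (w • (x : F) - K x)).im = w.im * ‖(x : F)‖ ^ 2 := by
      rw [inner_sub_right, inner_smul_right, inner_self_eq_norm_sq_to_K, Complex.sub_im, him]
      simp [← Complex.ofReal_pow]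
    have h2 : |w.im| * ‖(x : F)‖ ^ 2 ≤ ‖(x : F)‖ * ‖w • (x : F) - K x‖ := by
      rw [← abs_of_nonneg (sq_nonneg ‖(x : F)‖), ← abs_mul, ← h1]
      exact (Complex.abs_im_le_norm _).trans (norm_inner_le_norm _ _)
    rcases (norm_nonneg (x : F)).eq_or_lt with h0 | h0
    · rw [← h0]; simp
    · nlinarith
  have hcl : IsClosed (K.graph : Set (F × F)) := hK.isClosed
  have : CompleteSpace K.graph := hcl.completeSpace_coe
  let g : K.graph →L[ℂ] F :=
    (z • ContinuousLinearMap.fst ℂ F F - ContinuousLinearMap.snd ℂ F F) ∘L K.graph.subtypeL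
  have hg : ∀ p : K.graph, g p = z • (p : F × F).1 - (p : F × F).2 := fun p => rfl
  have hpos : 0 < |z.im| := abs_pos.mpr hz
  have hgb : ∀ p : K.graph, |z.im| * ‖(p : F × F).1‖ ≤ ‖g p‖ := by
    rintro ⟨⟨a, b⟩, hp⟩
    obtain ⟨y, hy1, hy2⟩ := (LinearPMap.mem_graph_iff _).mp hp
    simp only at hy1 hy2
    subst hy1 hy2
    exact hbound z y
  have hanti : AntilipschitzWith (Real.toNNReal (‖z‖ * |z.im|⁻¹ + 1 + |z.im|⁻¹)) g := by
    refine ContinuousLinearMap.antilipschitz_of_bound g fun p => ?_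
    rw [Real.coe_toNNReal _ (by positivity)]
    have h1 : ‖(p : F × F).1‖ ≤ |z.im|⁻¹ * ‖g p‖ := by
      rw [inv_mul_eq_div, le_div_iff₀ hpos, mul_comm]
      exact hgb p
    have h2 : ‖(p : F × F).2‖ ≤ ‖z‖ * (|z.im|⁻¹ * ‖g p‖) + ‖g p‖ := by
      have : (p : F × F).2 = z • (p : F × F).1 - g p := by rw [hg]; abel
      rw [this]
      refine (norm_sub_le _ _).trans ?_
      rw [norm_smul]
      gcongr
    have h3 : 0 ≤ ‖g p‖ := norm_nonneg _
    have h4 : 0 ≤ |z.im|⁻¹ * ‖g p‖ := by positivity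
    have h5 : 0 ≤ ‖z‖ * (|z.im|⁻¹ * ‖g p‖) := by positivity
    change max ‖(p : F × F).1‖ ‖(p : F × F).2‖ ≤ _
    refine max_le ?_ ?_ <;> nlinarith
  have hrcl : IsClosed (Set.range g) := hanti.isClosed_range g.uniformContinuous
  have hker : g.ker = ⊥ := LinearMap.ker_eq_bot.mpr hanti.injective
  have hrange : g.range = ⊤ := by
    have : CompleteSpace g.range := hrcl.completeSpace_coe
    rw [← Submodule.orthogonal_eq_bot_iff, Submodule.eq_bot_iff]
    intro y hy
    have hy' : ∀ x : K.domain, inner ℂ y (z • (x : F) - K x) = 0 := fun x =>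
      Submodule.inner_left_of_mem_orthogonal
        (K := g.range) ⟨⟨((x : F), K x), K.mem_graph x⟩, rfl⟩ hy
    have hy2 : ∀ x : K.domain, inner ℂ (starRingEnd ℂ z • y) (x : F) = inner ℂ y (K x) := by
      intro x
      have := hy' x
      rw [inner_sub_right, inner_smul_right, sub_eq_zero] at this
      rw [inner_smul_left, Complex.conj_conj, this]
    have hmem : y ∈ K.adjoint.domain := LinearPMap.mem_adjoint_domain_of_exists _ ⟨_, hy2⟩
    have hval := LinearPMap.adjoint_apply_eq hd ⟨y, hmem⟩ hy2
    have hmem' : y ∈ K.domain := hsa ▸ hmem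
    have hval' : K ⟨y, hmem'⟩ = starRingEnd ℂ z • y := by
      rw [← hval]
      exact ((LinearPMap.ext_iff.mp hsa).2 (hf := hmem) (hg := hmem')).symm
    have hb := hbound (starRingEnd ℂ z) ⟨y, hmem'⟩
    rw [hval'] at hb
    simp only [sub_self, norm_zero, Complex.conj_im, abs_neg] at hb
    exact norm_le_zero_iff.mp (nonpos_of_mul_nonpos_right hb hpos)
  let e := ContinuousLinearEquiv.ofBijective g hker hrange
  have he : ∀ p : K.graph, e p = g p := fun p => rfl
  refine ⟨(ContinuousLinearMap.fst ℂ F F ∘L K.graph.subtypeL) ∘L (e.symm : F →L[ℂ] K.graph), ?_⟩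
  have hQ : ∀ ψ : F, ∃ y : K.domain, (y : F) = (e.symm ψ : F × F).1 ∧ z • (y : F) - K y = ψ := by
    intro ψ
    obtain ⟨y, hy1, hy2⟩ := (LinearPMap.mem_graph_iff _).mp (e.symm ψ).2
    refine ⟨y, hy1, ?_⟩
    rw [hy1, hy2, ← hg, ← he, e.apply_symm_apply]
  refine ⟨fun ψ => ?_, fun ψ h => ?_, fun ψ => ?_⟩
  · obtain ⟨y, hy, -⟩ := hQ ψ
    change (e.symm ψ : F × F).1 ∈ K.domain
    exact hy ▸ y.2
  · obtain ⟨y, hy, hy2⟩ := hQ ψ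
    have : (⟨_, h⟩ : K.domain) = y := Subtype.ext hy.symm
    rw [this]
    change z • (e.symm ψ : F × F).1 - K y = ψ
    rw [← hy, hy2]
  · have : e ⟨((ψ : F), K ψ), K.mem_graph ψ⟩ = z • (ψ : F) - K ψ := rfl
    rw [← this]
    change (e.symm (e _) : F × F).1 = _
    rw [e.symm_apply_apply]

end Resolvent

section Krein

lemma adjoint_W {R : F →L[ℂ] F} (hR : IsSelfAdjoint R) (l : ℝ) (z : ℂ) :
    star (W R l z) = W R l (starRingEnd ℂ z) := by
  simp [W, hR.star_eq]

lemma mem_res_of_im_ne_zero {R : F →L[ℂ] F} (hR : IsSelfAdjoint R) (l : ℝ) {z : ℂ}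
    (hz : z.im ≠ 0) : z ∈ res R l := by
  have hne : z - (l : ℂ) ≠ 0 := fun h => hz (by simpa using congrArg Complex.im h)
  have hnot : -(z - (l : ℂ))⁻¹ ∉ spectrum ℂ R := fun h => by
    have := hR.im_eq_zero_of_mem_spectrum h
    simp [Complex.inv_im, hz, hne] at this
  rw [spectrum.notMem_iff] at hnot
  have : W R l z = (-(z - (l : ℂ))) • (algebraMap ℂ (F →L[ℂ] F) (-(z - (l : ℂ))⁻¹) - R) := by
    rw [W, smul_sub, Algebra.algebraMap_eq_smul_one, smul_smul, neg_mul_neg, mul_inv_cancel₀ hne,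
      one_smul, neg_smul, sub_neg_eq_add]
  change IsUnit (W R l z)
  rw [this]
  exact (isUnit_smul_iff (Units.mk0 _ (neg_ne_zero.mpr hne)) _).mpr hnot

lemma Gz_eq {R : F →L[ℂ] F} (hR : IsSelfAdjoint R) (B : F →L[ℂ] X) (l : ℝ) (z : ℂ) :
    Gz R B l z = Ring.inverse (W R l z) ∘L adjoint B := by
  rw [Gz, adjoint_comp, ← star_eq_adjoint (Ring.inverse _), ← Ring.inverse_star, adjoint_W hR,
    Complex.conj_conj]

lemma adjoint_Gz_conj (R : F →L[ℂ] F) (B : F →L[ℂ] X) (l : ℝ) (z : ℂ) :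
    adjoint (Gz R B l (starRingEnd ℂ z)) = B ∘L Ring.inverse (W R l z) := by
  rw [Gz, adjoint_adjoint, Complex.conj_conj]

lemma inverse_W_apply {R : F →L[ℂ] F} {l : ℝ} {z : ℂ} (hz : z ∈ res R l) (y : F) :
    Ring.inverse (W R l z) y = y - (z - (l : ℂ)) • R (Ring.inverse (W R l z) y) := by
  have := congrArg (fun T : F →L[ℂ] F => T y) (Ring.mul_inverse_cancel _ hz)
  rw [eq_sub_iff_add_eq]
  exact this

/-- The bounded operator `M_z = Σ (G - G_z)`. -/
def Mz (R : F →L[ℂ] F) (B : F →L[ℂ] X) (l : ℝ) (z : ℂ) : X →L[ℂ] X :=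
  (z - (l : ℂ)) • (B ∘L Gz R B l z)

lemma SigmaOf_eq_Mz {R : F →L[ℂ] F} (hR : IsSelfAdjoint R) (hinj : Function.Injective ⇑R)
    (B : F →L[ℂ] X) {l : ℝ} {z : ℂ} (hz : z ∈ res R l) (x : X) :
    SigmaOf R B ((Gz R B l l - Gz R B l z) x) = Mz R B l z x := by
  have h1 : (Gz R B l l - Gz R B l z) x = R ((z - (l : ℂ)) • Gz R B l z x) := by
    rw [sub_apply, Gz_eq hR, Gz_eq hR, comp_apply, comp_apply,
      inverse_W_apply hz (adjoint B x)]
    have : Ring.inverse (W R l l) = 1 := by simp [W]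
    rw [this, map_smul, one_apply_eq_self, ← inverse_W_apply hz]
    nth_rw 1 [inverse_W_apply hz]
    abel
  rw [h1, SigmaOf, Hinv, Function.leftInverse_invFun hinj, map_smul]
  rfl

lemma isBoundedInvOf_iff {R : F →L[ℂ] F} (hR : IsSelfAdjoint R) (hinj : Function.Injective ⇑R)
    (B : F →L[ℂ] X) {l : ℝ} {z : ℂ} (hz : z ∈ res R l) (Θ : X →ₗ.[ℂ] X) (J : X →L[ℂ] X) :
    IsBoundedInvOf Θ (fun x => SigmaOf R B ((Gz R B l l - Gz R B l z) x)) J ↔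
      IsBddInvOn Θ (-Mz R B l z) J := by
  simp only [SigmaOf_eq_Mz hR hinj B hz, IsBoundedInvOf, IsBddInvOn, neg_apply, sub_neg_eq_add]

/-- Perturbation of a bounded inverse: if `(Θ' - S') J` is boundedly invertible, where `J`
inverts `Θ - S` on the same domain, then so is `Θ' - S'`. -/
lemma IsBddInvOn.mul_inverse {Θ Θ' : X →ₗ.[ℂ] X} {S S' J T : X →L[ℂ] X}
    (hJ : IsBddInvOn Θ S J) (hdom : Θ'.domain = Θ.domain)
    (hT : ∀ (y : X) (h : J y ∈ Θ'.domain), Θ' ⟨J y, h⟩ - S' (J y) = T y) (hu : IsUnit T) :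
    IsBddInvOn Θ' S' (J ∘L Ring.inverse T) := by
  refine ⟨fun y => hdom ▸ hJ.1 _, fun y h => ?_, fun x => ?_⟩
  · exact (hT _ h).trans (congrArg (fun A : X →L[ℂ] X => A y) (Ring.mul_inverse_cancel _ hu))
  · have hx := hJ.2.2 ⟨x, hdom ▸ x.2⟩
    simp only at hx
    set u := Θ ⟨x, hdom ▸ x.2⟩ - S x with hu'
    have h2 : Θ' x - S' x = T u := by
      have hmem : J u ∈ Θ'.domain := by rw [hx]; exact x.2
      rw [← hT u hmem]
      have : (⟨J u, hmem⟩ : Θ'.domain) = x := Subtype.ext hx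
      rw [this, hx]
    rw [h2]
    have := congrArg (fun A : X →L[ℂ] X => A u) (Ring.inverse_mul_cancel _ hu)
    change J ((Ring.inverse T * T) u) = x
    rw [Ring.inverse_mul_cancel _ hu, one_apply_eq_self, hx]

lemma IsBddInvOn.eq_comp_inverse {Θ Θ' : X →ₗ.[ℂ] X} {S S' J T K : X →L[ℂ] X}
    (hJ : IsBddInvOn Θ S J) (hK : IsBddInvOn Θ' S' K) (hdom : Θ.domain ≤ Θ'.domain)
    (hT : ∀ (y : X) (h : J y ∈ Θ'.domain), Θ' ⟨J y, h⟩ - S' (J y) = T y) (hu : IsUnit T) :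
    K = J ∘L Ring.inverse T := by
  have h1 : K * T = J := by
    ext y
    have h := hdom (hJ.1 y)
    rw [mul_apply_eq_comp, ← hT y h]
    exact hK.2.2 ⟨J y, h⟩
  rw [← h1, ← mul_def, mul_assoc, Ring.mul_inverse_cancel _ hu, mul_one]

lemma isUnit_one_add_comp {C : F →L[ℂ] X} {D : X →L[ℂ] F} (h : IsUnit (1 + D ∘L C)) :
    IsUnit (1 + C ∘L D) := by
  obtain ⟨P, h1, h2⟩ := isUnit_iff_exists.mp h
  have h1' : ∀ x, P x + D (C (P x)) = x := fun x => congrArg (fun A : F →L[ℂ] F => A x) h1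
  have h2' : ∀ x, P (x + D (C x)) = x := fun x => congrArg (fun A : F →L[ℂ] F => A x) h2
  refine isUnit_iff_exists.mpr ⟨1 - C ∘L P ∘L D, ?_, ?_⟩
  · ext y
    change (y - C (P (D y))) + C (D (y - C (P (D y)))) = y
    have := congrArg C (h1' (D y))
    simp only [map_add, map_sub] at this ⊢
    rw [← this]
    abel
  · ext y
    change (y + C (D y)) - C (P (D (y + C (D y)))) = y
    have := congrArg C (h2' (D y))
    rw [map_add D, this]
    abel

lemma Mz_sub_Mz {R : F →L[ℂ] F} (hR : IsSelfAdjoint R) (B : F →L[ℂ] X) {l : ℝ} {z w : ℂ}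
    (hz : z ∈ res R l) (hw : w ∈ res R l) :
    Mz R B l z - Mz R B l w =
      (z - w) • ((B ∘L Ring.inverse (W R l w)) ∘L Gz R B l z) := by
  have key : (z - (l : ℂ)) • Ring.inverse (W R l z) - (w - (l : ℂ)) • Ring.inverse (W R l w) =
      (z - w) • (Ring.inverse (W R l w) * Ring.inverse (W R l z)) := by
    have h1 : (z - (l : ℂ)) • W R l w - (w - (l : ℂ)) • W R l z = (z - w) • 1 := by
      simp only [W]
      module
    have h2 := congrArg (fun A => Ring.inverse (W R l w) * A * Ring.inverse (W R l z)) h1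
    simpa [mul_sub, sub_mul, Ring.inverse_mul_cancel _ hw, mul_assoc,
      Ring.mul_inverse_cancel _ hz] using h2
  ext x
  have h := congrArg (fun A : F →L[ℂ] F => B (A (adjoint B x))) key
  simpa [Mz, Gz_eq hR] using h

/-- The set of regular points of `Θ + M` contains every regular point of `H` and `H_Θ`,
provided Kreĭn's formula holds at one point `w`. -/
lemma exists_isBddInvOn_of_isResolventAt {R : F →L[ℂ] F} (hR : IsSelfAdjoint R)
    (B : F →L[ℂ] X) {l : ℝ} {w z : ℂ} (hw : w ∈ res R l) (hz : z ∈ res R l)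
    {Θ : X →ₗ.[ℂ] X} {Hθ : F →ₗ.[ℂ] F} {J : X →L[ℂ] X} {Q : F →L[ℂ] F}
    (hJ : IsBddInvOn Θ (-Mz R B l w) J)
    (hres : IsResolventAt Hθ w
      (Rz R l w + Gz R B l w ∘L J ∘L (B ∘L Ring.inverse (W R l w))))
    (hQ : IsResolventAt Hθ z Q) :
    ∃ J' : X →L[ℂ] X, IsBddInvOn Θ (-Mz R B l z) J' := by
  set P := Rz R l w + Gz R B l w ∘L J ∘L (B ∘L Ring.inverse (W R l w)) with hP
  set C := B ∘L Ring.inverse (W R l w) with hC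
  set D := (z - w) • (Gz R B l z ∘L J) with hD
  have hGz : Gz R B l z = (Ring.inverse (W R l z) * W R l w) ∘L Gz R B l w := by
    rw [Gz_eq hR, Gz_eq hR, ← comp_assoc, ← mul_def, mul_assoc, Ring.mul_inverse_cancel _ hw,
      mul_one]
  have hu : IsUnit (1 + (z - w) • P) :=
    isUnit_iff_exists.mpr
      ⟨_, hres.one_add_mul_one_add hQ, hQ.one_add_mul_one_add hres⟩
  have hDC : 1 + D ∘L C = Ring.inverse (W R l z) * W R l w * (1 + (z - w) • P) := by
    have h1 : W R l w * Rz R l w = R := by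
      have hc : Commute R (W R l w) :=
        (Commute.one_right R).add_right ((Commute.refl R).smul_right _)
      rw [Rz, ← mul_def, ← mul_assoc, ← hc.eq, mul_assoc, Ring.mul_inverse_cancel _ hw, mul_one]
    have h2 : W R l w + (z - w) • R = W R l z := by
      simp only [W]
      module
    have h3 : D ∘L C = (z - w) • (Ring.inverse (W R l z) * W R l w * (P - Rz R l w)) := by
      rw [hP, add_sub_cancel_left, hD, hGz]
      rfl
    have h4 : W R l w * (1 + (z - w) • P) =
        W R l z + (z - w) • (W R l w * (P - Rz R l w)) := by
      rw [mul_sub, h1, ← h2, mul_add, mul_one, mul_smul_comm]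
      module
    rw [h3, mul_assoc _ _ (1 + _), h4, mul_add, Ring.inverse_mul_cancel _ hz, mul_smul_comm,
      mul_assoc]
  have hunit : IsUnit (1 + C ∘L D) := by
    refine isUnit_one_add_comp ?_
    rw [hDC]
    exact (hz.ringInverse.mul hw).mul hu
  refine ⟨_, hJ.mul_inverse rfl (fun y h => ?_) hunit⟩
  have h1 := hJ.2.1 y h
  have h2 := congrArg (fun A : X →L[ℂ] X => A (J y)) (Mz_sub_Mz hR B hz hw)
  have h3 : Mz R B l z (J y) - Mz R B l w (J y) = C (D y) := by
    simpa [hC, hD] using h2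
  rw [neg_apply, sub_neg_eq_add] at h1 ⊢
  change _ = y + C (D y)
  rw [← h3, eq_sub_of_add_eq h1]
  abel

lemma tendsto_clm_comp {E G H : Type*} [NormedAddCommGroup E] [NormedSpace ℂ E]
    [NormedAddCommGroup G] [NormedSpace ℂ G] [NormedAddCommGroup H] [NormedSpace ℂ H]
    {a : ℕ → G →L[ℂ] H} {b : ℕ → E →L[ℂ] G} {a₀ : G →L[ℂ] H} {b₀ : E →L[ℂ] G}
    (ha : Tendsto a atTop (nhds a₀)) (hb : Tendsto b atTop (nhds b₀)) :
    Tendsto (fun n => a n ∘L b n) atTop (nhds (a₀ ∘L b₀)) :=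
  (isBoundedBilinearMap_comp.continuous.tendsto (a₀, b₀)).comp (ha.prodMk_nhds hb)

lemma tendsto_Gz (R : F →L[ℂ] F) {B : F →L[ℂ] X} {Bn : ℕ → F →L[ℂ] X} (l : ℝ) (z : ℂ)
    (h : Tendsto Bn atTop (nhds B)) :
    Tendsto (fun n => Gz R (Bn n) l z) atTop (nhds (Gz R B l z)) :=
  (adjoint.continuous.tendsto _).comp (tendsto_clm_comp h tendsto_const_nhds)

/-- If `Θₙ - Eₙ → Θ` relative to the graph norm of `Θ`, then `(Θₙ - Σₙ R_w Σₙ*) J → 1` in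
operator norm, where `J = (Θ + M_w)⁻¹`. -/
lemma exists_tendsto_one {R : F →L[ℂ] F} {B : F →L[ℂ] X} {Bn : ℕ → F →L[ℂ] X} {l : ℝ} {w : ℂ}
    {Θ : X →ₗ.[ℂ] X} {Θn : ℕ → X →ₗ.[ℂ] X} {En : ℕ → X →L[ℂ] X} {J : X →L[ℂ] X}
    (hJ : IsBddInvOn Θ (-Mz R B l w) J) (hdom : ∀ n, Θ.domain ≤ (Θn n).domain)
    (hB : Tendsto Bn atTop (nhds B))
    (hT : ∃ ε : ℕ → ℝ, Tendsto ε atTop (nhds 0) ∧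
      ∀ (n : ℕ) (φ : X) (hφ : φ ∈ Θ.domain) (hφn : φ ∈ (Θn n).domain),
        ‖Θn n ⟨φ, hφn⟩ - En n φ - Θ ⟨φ, hφ⟩‖ ≤ ε n * (‖φ‖ + ‖Θ ⟨φ, hφ⟩‖)) :
    ∃ T : ℕ → X →L[ℂ] X, Tendsto T atTop (nhds 1) ∧
      ∀ (n : ℕ) (y : X) (h : J y ∈ (Θn n).domain),
        Θn n ⟨J y, h⟩ - SRS R (Bn n) (En n) l w (J y) = T n y := by
  obtain ⟨ε, hε, hT⟩ := hT
  have hΘJ : ∀ y, Θ ⟨J y, hJ.1 y⟩ = y - Mz R B l w (J y) := fun y => by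
    have := hJ.2.1 y (hJ.1 y)
    rw [neg_apply, sub_neg_eq_add] at this
    exact eq_sub_of_add_eq this
  let A : ℕ → X →ₗ[ℂ] X := fun n =>
    (Θn n).toFun ∘ₗ (J.toLinearMap.codRestrict (Θn n).domain fun y => hdom n (hJ.1 y)) -
      (En n ∘L J).toLinearMap - (1 - Mz R B l w ∘L J : X →L[ℂ] X).toLinearMap
  have hA : ∀ n y, A n y = Θn n ⟨J y, hdom n (hJ.1 y)⟩ - En n (J y) - (y - Mz R B l w (J y)) :=
    fun n y => rfl
  let c : ℝ := ‖J‖ + ‖(1 - Mz R B l w ∘L J : X →L[ℂ] X)‖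
  have hbd : ∀ n y, ‖A n y‖ ≤ |ε n| * c * ‖y‖ := by
    intro n y
    have h1 : ‖J y‖ ≤ ‖J‖ * ‖y‖ := J.le_opNorm y
    have h2 : ‖y - Mz R B l w (J y)‖ ≤ ‖(1 - Mz R B l w ∘L J : X →L[ℂ] X)‖ * ‖y‖ :=
      (1 - Mz R B l w ∘L J : X →L[ℂ] X).le_opNorm y
    have h3 := hT n (J y) (hJ.1 y) (hdom n (hJ.1 y))
    rw [hΘJ] at h3
    rw [hA]
    calc _ ≤ ε n * (‖J y‖ + ‖y - Mz R B l w (J y)‖) := h3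
      _ ≤ |ε n| * (‖J y‖ + ‖y - Mz R B l w (J y)‖) := by gcongr; exact le_abs_self _
      _ ≤ |ε n| * (‖J‖ * ‖y‖ + ‖(1 - Mz R B l w ∘L J : X →L[ℂ] X)‖ * ‖y‖) := by gcongr
      _ = |ε n| * c * ‖y‖ := by ring
  let D : ℕ → X →L[ℂ] X := fun n => (A n).mkContinuous _ (hbd n)
  have hD : Tendsto D atTop (nhds 0) := by
    refine squeeze_zero_norm (fun n => (A n).mkContinuous_norm_le (by positivity) (hbd n)) ?_
    simpa using hε.abs.mul_const c
  have hM : Tendsto (fun n => Mz R (Bn n) l w) atTop (nhds (Mz R B l w)) :=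
    (tendsto_clm_comp hB (tendsto_Gz R l w hB)).const_smul _
  refine ⟨fun n => 1 + D n + (Mz R (Bn n) l w - Mz R B l w) ∘L J, ?_, fun n y h => ?_⟩
  · simpa using (hD.const_add 1).add (tendsto_clm_comp (hM.sub_const (Mz R B l w))
      (tendsto_const_nhds (x := J)))
  · have h1 : SRS R (Bn n) (En n) l w (J y) = En n (J y) - Mz R (Bn n) l w (J y) := by
      rw [SRS, Mz, ← neg_sub w (l : ℂ), neg_smul, ← sub_eq_add_neg]
      rfl
    have h2 : (1 + D n + (Mz R (Bn n) l w - Mz R B l w) ∘L J) y =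
      y + A n y + (Mz R (Bn n) l w (J y) - Mz R B l w (J y)) := rfl
    rw [h1, h2, hA]
    abel

end Krein

/-- Approximation by regular perturbations: under the stated
hypotheses, `Hₙ = H + Σₙ* Θₙ⁻¹ Σₙ` converges to `H_Θ` in norm-resolvent sense, i.e.
`‖(-Hₙ + z)⁻¹ - (-H_Θ + z)⁻¹‖ → 0` for every `z ∈ ℂ ∖ ℝ`. -/
theorem statement8
    (R : F →L[ℂ] F) (B : F →L[ℂ] X) (l : ℝ)
    (hR : IsSelfAdjoint R) (hinj : Function.Injective ⇑R)
    (Θ : X →ₗ.[ℂ] X) (hΘ : IsSelfAdjoint Θ)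
    -- (a) `H_Θ` self-adjoint, `Z_{Σ,Θ} ≠ ∅`, Kreĭn resolvent formula on `Z_{Σ,Θ}`
    (Hθ : F →ₗ.[ℂ] F) (hHθsa : IsSelfAdjoint Hθ)
    (hZne : (ZSet R B l Θ).Nonempty)
    (hHθres : ∀ z ∈ ZSet R B l Θ, z ∈ pres Hθ ∧
      ∀ J : X →L[ℂ] X,
        IsBoundedInvOf Θ (fun x => SigmaOf R B ((Gz R B l l - Gz R B l z) x)) J →
        IsResolventAt Hθ z
          (Rz R l z + Gz R B l z ∘L J ∘L adjoint (Gz R B l (starRingEnd ℂ z))))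
    -- (b) the operators `Σₙ`, encoded through `Bn n = Σₙ ∘ R`
    (Sn : ℕ → F →ₗ.[ℂ] X) (Bn : ℕ → F →L[ℂ] X)
    (hSndom : ∀ n, Set.range ⇑R ⊆ ((Sn n).domain : Set F))
    (hSndense : ∀ n, Dense ((Sn n).domain : Set F))
    (hSnclos : ∀ n, (Sn n).IsClosable)
    (hBn : ∀ (n : ℕ) (χ : F) (h : R χ ∈ (Sn n).domain), Sn n ⟨R χ, h⟩ = Bn n χ)
    -- (c) the operators `Θₙ`, self-adjoint with `dom Θₙ ⊇ dom Θ` and `0 ∈ ϱ(Θₙ)`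
    (Θn : ℕ → X →ₗ.[ℂ] X) (hΘnsa : ∀ n, IsSelfAdjoint (Θn n))
    (hΘndom : ∀ n, Θ.domain ≤ (Θn n).domain)
    (J0 : ℕ → X →L[ℂ] X)
    (hJ0 : ∀ n, (∀ y : X, J0 n y ∈ (Θn n).domain) ∧
      (∀ (y : X) (h : J0 n y ∈ (Θn n).domain), Θn n ⟨J0 n y, h⟩ = y) ∧
      (∀ x : (Θn n).domain, J0 n (Θn n x) = (x : X)))
    -- (d) the bounded extensions `En n` of `Σₙ R Σₙ*`
    (En : ℕ → X →L[ℂ] X)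
    (hEn : ∀ (n : ℕ) (φ : (Sn n).adjoint.domain),
      En n (φ : X) = Bn n ((Sn n).adjoint φ))
    -- (e) the operators `Hₙ = H + Σₙ* Θₙ⁻¹ Σₙ`, self-adjoint with `dom Hₙ = 𝔥₁`
    (Hn : ℕ → F →ₗ.[ℂ] F) (hHnsa : ∀ n, IsSelfAdjoint (Hn n))
    (hHndom : ∀ n, ((Hn n).domain : Set F) = Set.range ⇑R)
    (hHnact : ∀ (n : ℕ) (χ : F) (h : R χ ∈ (Hn n).domain),
      ∃ h2 : J0 n (Bn n χ) ∈ (Sn n).adjoint.domain,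
        Hn n ⟨R χ, h⟩ = (l : ℂ) • R χ - χ + (Sn n).adjoint ⟨J0 n (Bn n χ), h2⟩)
    (hHnres : ∀ (n : ℕ) (z : ℂ), z ∈ res R l → z ∈ pres (Hn n) →
      ∀ K : X →L[ℂ] X, IsBddInvOn (Θn n) (SRS R (Bn n) (En n) l z) K →
        IsResolventAt (Hn n) z
          (Rz R l z + Gz R (Bn n) l z ∘L K ∘L (Bn n ∘L Ring.inverse (W R l z))))
    -- convergence hypotheses
    (hBconv : Tendsto (fun n => ‖Bn n - B‖) atTop (nhds 0))
    (hTconv : ∃ ε : ℕ → ℝ, Tendsto ε atTop (nhds 0) ∧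
      ∀ (n : ℕ) (φ : X) (hφ : φ ∈ Θ.domain) (hφn : φ ∈ (Θn n).domain),
        ‖Θn n ⟨φ, hφn⟩ - En n φ - Θ ⟨φ, hφ⟩‖ ≤ ε n * (‖φ‖ + ‖Θ ⟨φ, hφ⟩‖))
    (hest : (∀ n, (Θn n).domain = Θ.domain) ∨
      ∃ zp : ℂ, 0 < zp.im ∧
        (∀ n, ∀ w ∈ ({zp, starRingEnd ℂ zp} : Set ℂ),
          ∃ K : X →L[ℂ] X, IsBddInvOn (Θn n) (SRS R (Bn n) (En n) l w) K) ∧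
        (∀ φ : X, ∃ c : ℝ, ∀ n, ∀ w ∈ ({zp, starRingEnd ℂ zp} : Set ℂ),
          ∀ K : X →L[ℂ] X, IsBddInvOn (Θn n) (SRS R (Bn n) (En n) l w) K →
            ‖K φ‖ ≤ c)) :
    ∀ z : ℂ, z.im ≠ 0 →
      ∀ (Q : F →L[ℂ] F) (Qn : ℕ → F →L[ℂ] F),
        IsResolventAt Hθ z Q → (∀ n, IsResolventAt (Hn n) z (Qn n)) →
        Tendsto (fun n => ‖Qn n - Q‖) atTop (nhds 0) := by
  intro z hz Q Qn hQ hQn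
  have hB : Tendsto Bn atTop (nhds B) := tendsto_iff_norm_sub_tendsto_zero.mpr hBconv
  rw [← tendsto_iff_norm_sub_tendsto_zero]
  obtain ⟨w, hw, hex⟩ : ∃ w : ℂ, w.im ≠ 0 ∧ ((∀ n, (Θn n).domain = Θ.domain) ∨
      ∀ n, ∃ K : X →L[ℂ] X, IsBddInvOn (Θn n) (SRS R (Bn n) (En n) l w) K) := by
    rcases hest with h | ⟨zp, hzp, hK, -⟩
    · exact ⟨z, hz, Or.inl h⟩
    · exact ⟨zp, hzp.ne', Or.inr fun n => hK n zp (Or.inl rfl)⟩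
  have hwres : w ∈ res R l := mem_res_of_im_ne_zero hR l hw
  obtain ⟨P, hP⟩ := mem_pres_of_isSelfAdjoint hHθsa hw
  choose Pn hPn using fun n => mem_pres_of_isSelfAdjoint (hHnsa n) hw
  obtain ⟨z₀, hz₀⟩ := hZne
  obtain ⟨hz₀res, J₀, hJ₀⟩ := id hz₀
  have hkrein := (hHθres z₀ hz₀).2 J₀ hJ₀
  rw [adjoint_Gz_conj] at hkrein
  obtain ⟨J, hJ⟩ := exists_isBddInvOn_of_isResolventAt hR B hz₀res hwres
    ((isBoundedInvOf_iff hR hinj B hz₀res Θ J₀).mp hJ₀) hkrein hP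
  have hJ' := (isBoundedInvOf_iff hR hinj B hwres Θ J).mpr hJ
  have hPeq := hP.eq ((hHθres w ⟨hwres, J, hJ'⟩).2 J hJ')
  rw [adjoint_Gz_conj] at hPeq
  obtain ⟨T, hT1, hT⟩ := exists_tendsto_one hJ hΘndom hB hTconv
  have hTu : ∀ᶠ n in atTop, IsUnit (T n) :=
    hT1.eventually (Units.isOpen.mem_nhds isUnit_one)
  have hKn : ∀ᶠ n in atTop,
      IsBddInvOn (Θn n) (SRS R (Bn n) (En n) l w) (J ∘L Ring.inverse (T n)) := by
    filter_upwards [hTu] with n hu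
    rcases hex with h | h
    · exact hJ.mul_inverse (h n) (hT n) hu
    · obtain ⟨K, hK⟩ := h n
      exact hJ.eq_comp_inverse hK (hΘndom n) (hT n) hu ▸ hK
  have hTinv : Tendsto (Ring.inverse ∘ T) atTop (nhds 1) := by
    simpa using (NormedRing.inverse_continuousAt (1 : (X →L[ℂ] X)ˣ)).tendsto.comp hT1
  have hKlim : Tendsto (fun n => J ∘L Ring.inverse (T n)) atTop (nhds J) := by
    exact tendsto_clm_comp (tendsto_const_nhds (x := J)) hTinv
  have hPlim : Tendsto Pn atTop (nhds P) := by
    rw [hPeq]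
    refine Tendsto.congr' ?_ ((tendsto_clm_comp (tendsto_Gz R l w hB) (tendsto_clm_comp hKlim
      (tendsto_clm_comp hB (tendsto_const_nhds (x := Ring.inverse (W R l w)))))).const_add (Rz R l w))
    filter_upwards [hKn] with n hK
    exact (hHnres n w hwres ⟨_, hPn n⟩ _ hK).eq (hPn n)
  exact hP.tendsto_of_tendsto hQ hPn hQn hPlim
end
end

section
/- dom(Ŝ^×) ⊆ {ψ ∈ dom(S^×) : A_*ψ ∈ dom(T)} ⊆ dom(S^×), and for every ψ ∈ dom(Ŝ^×) one has Ŝ^×ψ = S^×ψ + A_Tψ. In particular, the restriction of Ŝ^× to dom(Ŝ^×) ∩ ker(Σ̂) is a restriction of the symmetric operator S^×_T. -/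
noncomputable section

open scoped ComplexInnerProductSpace
open ContinuousLinearMap Filter

variable {F X : Type*}
  [NormedAddCommGroup F] [InnerProductSpace ℂ F] [CompleteSpace F]
  [NormedAddCommGroup X] [InnerProductSpace ℂ X] [CompleteSpace X]

/-- `A_* ψ`: the (for `ψ ∈ dom S^×` unique) `φ` with `ψ - G φ ∈ 𝔥₁ = ran R`. -/
def Astar (R B : F →L[ℂ] F) (l : ℝ) (ψ : F) : F :=
  Classical.epsilon fun φ : F => ψ - Gz R B l l φ ∈ Set.range ⇑R

/-- `Σ̂ ψ = (1 - A_*) ψ`. -/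
def SigmaHat (R B : F →L[ℂ] F) (l : ℝ) (ψ : F) : F := ψ - Astar R B l ψ

/-- `A₀ ψ = A ψ₀`, where `ψ₀ = ψ - G (A_* ψ)`. -/
def Azero (R B : F →L[ℂ] F) (l : ℝ) (ψ : F) : F :=
  B (Hinv R (ψ - Gz R B l l (Astar R B l ψ)))

/-- `S^× ψ = λ₀ ψ - (-H + λ₀) ψ₀`, where `ψ₀ = ψ - G (A_* ψ)`. -/
def SxFun (R B : F →L[ℂ] F) (l : ℝ) (ψ : F) : F :=
  (l : ℂ) • ψ - Hinv R (ψ - Gz R B l l (Astar R B l ψ))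

/-- `K ∈ B(𝔉)` is a two-sided bounded inverse of `A_T G_z = T - A (G - G_z)`
(with domain `dom T`). -/
def IsInvATG (R B : F →L[ℂ] F) (l : ℝ) (T : F →ₗ.[ℂ] F) (z : ℂ)
    (K : F →L[ℂ] F) : Prop :=
  (∀ y : F, K y ∈ T.domain) ∧
  (∀ (y : F) (h : K y ∈ T.domain),
    T ⟨K y, h⟩ - SigmaOf R B ((Gz R B l l - Gz R B l z) (K y)) = y) ∧
  (∀ x : T.domain,
    K (T x - SigmaOf R B ((Gz R B l l - Gz R B l z) (x : F))) = (x : F))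

lemma gz_base (R : F →L[ℂ] F) (B : F →L[ℂ] X) (l : ℝ) : Gz R B l l = adjoint B := by
  have hone : Ring.inverse (1 : F →L[ℂ] F) = 1 := Ring.inverse_one _
  have hW : W R l (l : ℂ) = 1 := by simp [W]
  rw [Gz, Complex.conj_ofReal, hW, hone]
  rfl

lemma isSelfAdjoint_W {R : F →L[ℂ] F} (hR : IsSelfAdjoint R) (l m : ℝ) :
    IsSelfAdjoint (W R l (m : ℂ)) := by
  have hc : IsSelfAdjoint ((m : ℂ) - (l : ℂ)) := by
    simp [isSelfAdjoint_iff]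
  exact (IsSelfAdjoint.one _).add (hc.smul hR)

lemma isSelfAdjoint_inverse_W {R : F →L[ℂ] F} (hR : IsSelfAdjoint R) (l m : ℝ) :
    IsSelfAdjoint (Ring.inverse (W R l (m : ℂ))) := by
  rw [isSelfAdjoint_iff, ← Ring.inverse_star, (isSelfAdjoint_W hR l m).star_eq]

lemma gz_apply {R : F →L[ℂ] F} (hR : IsSelfAdjoint R) (B : F →L[ℂ] X) (l m : ℝ) (x : X) :
    Gz R B l m x = Ring.inverse (W R l (m : ℂ)) (adjoint B x) := by
  have hW := isSelfAdjoint_iff'.mp (isSelfAdjoint_inverse_W hR l m)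
  rw [Gz, Complex.conj_ofReal, adjoint_comp, hW]
  rfl

lemma gz_base_eq {R : F →L[ℂ] F} (hR : IsSelfAdjoint R) (B : F →L[ℂ] X) {l m : ℝ}
    (hm : (m : ℂ) ∈ res R l) (x : X) :
    Gz R B l l x = Gz R B l m x + R (((m : ℂ) - l) • Gz R B l m x) := by
  have h : W R l (m : ℂ) (Gz R B l m x) = adjoint B x := by
    rw [gz_apply hR, ← mul_apply_eq_comp, Ring.mul_inverse_cancel _ hm, one_apply_eq_self]
  rw [gz_base, ← h]
  simp [W]

lemma hinv_apply {E : Type*} [NormedAddCommGroup E] [InnerProductSpace ℂ E] {R : E →L[ℂ] E}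
    (hinj : Function.Injective ⇑R) (u : E) : Hinv R (R u) = u :=
  Function.leftInverse_invFun hinj u

lemma sigmaOf_gz_sub {R : F →L[ℂ] F} (hR : IsSelfAdjoint R) (hinj : Function.Injective ⇑R)
    (B : F →L[ℂ] X) {l m : ℝ} (hm : (m : ℂ) ∈ res R l) (x : X) :
    SigmaOf R B ((Gz R B l l - Gz R B l m) x) = ((m : ℂ) - l) • B (Gz R B l m x) := by
  have h : (Gz R B l l - Gz R B l m) x = R (((m : ℂ) - l) • Gz R B l m x) := by
    rw [sub_apply, gz_base_eq hR B hm]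
    abel
  rw [SigmaOf, h, hinv_apply hinj, map_smul]

lemma inner_sigmaOf_gz_sub {R : F →L[ℂ] F} (hR : IsSelfAdjoint R)
    (hinj : Function.Injective ⇑R) (B : F →L[ℂ] X) {l m : ℝ} (hm : (m : ℂ) ∈ res R l)
    (x y : X) :
    ⟪SigmaOf R B ((Gz R B l l - Gz R B l m) x), y⟫
      = ⟪x, SigmaOf R B ((Gz R B l l - Gz R B l m) y)⟫ := by
  have hW := isSelfAdjoint_iff'.mp (isSelfAdjoint_inverse_W hR l m)
  rw [sigmaOf_gz_sub hR hinj B hm, sigmaOf_gz_sub hR hinj B hm, inner_smul_left,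
    inner_smul_right, ← adjoint_inner_right B, ← adjoint_inner_left B, gz_apply hR,
    gz_apply hR, ← adjoint_inner_right, hW]
  simp

lemma inner_map_eq_of_isSelfAdjoint {T : F →ₗ.[ℂ] F} (hT : IsSelfAdjoint T) (x y : T.domain) :
    ⟪T x, (y : F)⟫ = ⟪(x : F), T y⟫ := by
  have h := LinearPMap.adjoint_isFormalAdjoint hT.dense_domain
  rw [LinearPMap.isSelfAdjoint_def.mp hT] at h
  exact h x y

lemma IsInvATG.inner_eq {R B : F →L[ℂ] F} (hR : IsSelfAdjoint R)
    (hinj : Function.Injective ⇑R) {l m : ℝ} (hm : (m : ℂ) ∈ res R l) {T : F →ₗ.[ℂ] F}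
    (hT : IsSelfAdjoint T) {K : F →L[ℂ] F} (hK : IsInvATG R B l T m K) (x y : F) :
    ⟪K x, y⟫ = ⟪x, K y⟫ := by
  have hx := hK.2.1 x (hK.1 x)
  have hy := hK.2.1 y (hK.1 y)
  have hTs := inner_map_eq_of_isSelfAdjoint hT ⟨K x, hK.1 x⟩ ⟨K y, hK.1 y⟩
  calc ⟪K x, y⟫ = ⟪K x, T ⟨K y, hK.1 y⟩ - SigmaOf R B ((Gz R B l l - Gz R B l m) (K y))⟫ := by
        rw [hy]
    _ = ⟪T ⟨K x, hK.1 x⟩ - SigmaOf R B ((Gz R B l l - Gz R B l m) (K x)), K y⟫ := by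
        rw [inner_sub_right, inner_sub_left, hTs, inner_sigmaOf_gz_sub hR hinj B hm]
    _ = ⟪x, K y⟫ := by rw [hx]

lemma IsResolventAt.inner_eq {K : F →ₗ.[ℂ] F} (hK : IsSelfAdjoint K) {m : ℝ} {Q : F →L[ℂ] F}
    (hQ : IsResolventAt K m Q) (x y : F) : ⟪Q x, y⟫ = ⟪x, Q y⟫ := by
  have hx := hQ.2.1 x (hQ.1 x)
  have hy := hQ.2.1 y (hQ.1 y)
  have hs := inner_map_eq_of_isSelfAdjoint hK ⟨Q x, hQ.1 x⟩ ⟨Q y, hQ.1 y⟩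
  calc ⟪Q x, y⟫ = ⟪Q x, (m : ℂ) • Q y - K ⟨Q y, hQ.1 y⟩⟫ := by rw [hy]
    _ = ⟪(m : ℂ) • Q x - K ⟨Q x, hQ.1 x⟩, Q y⟫ := by
        rw [inner_sub_right, inner_sub_left, hs, inner_smul_left, inner_smul_right,
          Complex.conj_ofReal]
    _ = ⟪x, Q y⟫ := by rw [hx]

lemma astar_eq {R B : F →L[ℂ] F} {l : ℝ} (hkerG : Function.Injective ⇑(Gz R B l l))
    (hranG : Set.range ⇑(Gz R B l l) ∩ Set.range ⇑R = {0}) {ψ φ : F}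
    (h : ψ - Gz R B l l φ ∈ Set.range ⇑R) : Astar R B l ψ = φ := by
  have he : ψ - Gz R B l l (Astar R B l ψ) ∈ Set.range ⇑R :=
    Classical.epsilon_spec (p := fun φ : F => ψ - Gz R B l l φ ∈ Set.range ⇑R) ⟨φ, h⟩
  obtain ⟨u, hu⟩ := h
  obtain ⟨v, hv⟩ := he
  have hmem : Gz R B l l (Astar R B l ψ - φ) ∈ Set.range ⇑(Gz R B l l) ∩ Set.range ⇑R := by
    refine ⟨⟨_, rfl⟩, u - v, ?_⟩
    rw [map_sub, map_sub, hu, hv]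
    abel
  rw [hranG, Set.mem_singleton_iff, ← map_zero (Gz R B l l)] at hmem
  exact sub_eq_zero.mp (hkerG hmem)

/-- `dom Ŝ^× ⊆ {ψ ∈ dom S^× : A_* ψ ∈ dom T} ⊆ dom S^×`, and for every
`ψ ∈ dom Ŝ^×` one has `Ŝ^× ψ = S^× ψ + A_T ψ`.  In particular, the restriction of `Ŝ^×`
to `dom Ŝ^× ∩ ker Σ̂` is a restriction of the symmetric operator `S^×_T`.
(Here `λ̂₀ = lh ∈ ℝ ∩ ϱ(H) ∩ ϱ(H_T)` is fixed, `Ĝ = Ĝ_{λ̂₀}`, `ψ ∈ dom Ŝ^×` is written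
as `ψ = ψ̂₀ + Ĝ φ` with `ψ̂₀ = ψ - Ĝ φ ∈ dom H_T`, and
`Ŝ^× ψ = λ̂₀ ψ - (-H_T + λ̂₀) ψ̂₀`.) -/
theorem statement14
    (R B : F →L[ℂ] F) (l : ℝ)
    (hR : IsSelfAdjoint R) (hinj : Function.Injective ⇑R)
    (hkerG : Function.Injective ⇑(Gz R B l l))
    (hranG : Set.range ⇑(Gz R B l l) ∩ Set.range ⇑R = {0})
    (T : F →ₗ.[ℂ] F) (hT : IsSelfAdjoint T)
    (HT : F →ₗ.[ℂ] F) (hHTsa : IsSelfAdjoint HT)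
    (hHTdom : (HT.domain : Set F)
      = {ψ | ∃ (φ : F) (h : ψ - Gz R B l l φ ∈ Set.range ⇑R) (hφ : φ ∈ T.domain),
          SigmaOf R B (ψ - Gz R B l l φ) + T ⟨φ, hφ⟩ = 0})
    (hHTact : ∀ (ψ : HT.domain) (φ : F),
      (ψ : F) - Gz R B l l φ ∈ Set.range ⇑R →
      HT ψ = (l : ℂ) • (ψ : F) - Hinv R ((ψ : F) - Gz R B l l φ))
    (hZeq : ∀ z : ℂ, z ∈ res R l ∩ pres HT ↔
      (z ∈ res R l ∧ ∃ K : F →L[ℂ] F, IsInvATG R B l T z K))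
    (hZne : (res R l ∩ pres HT).Nonempty)
    (hHTres : ∀ z ∈ res R l ∩ pres HT, ∀ K : F →L[ℂ] F, IsInvATG R B l T z K →
      IsResolventAt HT z
        (Rz R l z - Gz R B l z ∘L K ∘L adjoint (Gz R B l (starRingEnd ℂ z))))
    (Ghat : ℂ → F →L[ℂ] F)
    (hGhat : ∀ z ∈ pres HT, ∀ Q : F →L[ℂ] F,
      IsResolventAt HT (starRingEnd ℂ z) Q →
      ∀ φ ψ : F, ⟪Ghat z φ, ψ⟫ = ⟪φ, SigmaHat R B l (Q ψ)⟫)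
    (lh : ℝ) (hlh : (lh : ℂ) ∈ res R l ∩ pres HT)
    (ψ φ : F) (h : ψ - Ghat (lh : ℂ) φ ∈ HT.domain) :
    ((∃ φ0 : F, ψ - Gz R B l l φ0 ∈ Set.range ⇑R) ∧ Astar R B l ψ ∈ T.domain) ∧
    (∀ hA : Astar R B l ψ ∈ T.domain,
      (lh : ℂ) • ψ
          - ((lh : ℂ) • (ψ - Ghat (lh : ℂ) φ) - HT ⟨ψ - Ghat (lh : ℂ) φ, h⟩)
        = SxFun R B l ψ + (Azero R B l ψ + T ⟨Astar R B l ψ, hA⟩)) ∧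
    (SigmaHat R B l ψ = 0 →
      ψ ∈ T.domain ∧ ψ - Gz R B l l ψ ∈ Set.range ⇑R) := by
  obtain ⟨hres, K, hK⟩ := (hZeq _).mp hlh
  have hQ := hHTres _ hlh K hK
  set Q : F →L[ℂ] F :=
    Rz R l lh - Gz R B l lh ∘L K ∘L adjoint (Gz R B l (starRingEnd ℂ (lh : ℂ))) with hQdef
  have hG := gz_base_eq hR B hres
  have hSigma (χ : F) : SigmaHat R B l (Q χ) = Q χ + K (adjoint (Gz R B l lh) χ) := by
    have hAstar : Astar R B l (Q χ) = -K (adjoint (Gz R B l lh) χ) := by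
      refine astar_eq hkerG hranG ⟨Ring.inverse (W R l (lh : ℂ)) χ
        + ((lh : ℂ) - l) • Gz R B l lh (K (adjoint (Gz R B l lh) χ)), ?_⟩
      rw [map_neg, hG, map_add, hQdef, Complex.conj_ofReal]
      simp only [Rz, sub_apply, comp_apply]
      abel
    rw [SigmaHat, hAstar, sub_neg_eq_add]
  have hGhat_apply : Ghat lh φ = Q φ + Gz R B l lh (K φ) := by
    refine ext_inner_right ℂ fun χ => ?_
    rw [hGhat lh hlh.2 Q (by rwa [Complex.conj_ofReal]), hSigma, inner_add_right, inner_add_left,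
      hQ.inner_eq hHTsa, ← adjoint_inner_right (Gz R B l lh), hK.inner_eq hR hinj hres hT]
  have hdecomp (χ : HT.domain) : ∃ (u : F) (a : T.domain),
      (χ : F) - Gz R B l l a = R u ∧ B u + T a = 0 ∧ HT χ = (l : ℂ) • (χ : F) - u := by
    have hχ : (χ : F) ∈ (HT.domain : Set F) := χ.2
    rw [hHTdom] at hχ
    obtain ⟨a, ⟨u, hu⟩, ha, hsum⟩ := hχ
    have hact := hHTact χ a ⟨u, hu⟩
    rw [← hu, hinv_apply hinj] at hact
    rw [SigmaOf, ← hu, hinv_apply hinj] at hsum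
    exact ⟨u, ⟨a, ha⟩, hu.symm, hsum, hact⟩
  obtain ⟨u₁, a₁, hu₁, hs₁, hH₁⟩ := hdecomp ⟨_, h⟩
  obtain ⟨u₂, a₂, hu₂, hs₂, hH₂⟩ := hdecomp ⟨Q φ, hQ.1 φ⟩
  have hQφ := hQ.2.1 φ (hQ.1 φ)
  have hKφ := hK.2.1 φ (hK.1 φ)
  set a₃ : T.domain := ⟨K φ, hK.1 φ⟩
  set g : F := Gz R B l lh (K φ) with hg
  rw [sigmaOf_gz_sub hR hinj B hres, ← hg] at hKφ
  have hψ : ψ - Gz R B l l ((a₁ + a₂ + a₃ : T.domain) : F)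
      = R (u₁ + u₂ - ((lh : ℂ) - l) • g) := by
    have h₃ : Gz R B l l (a₃ : F) = g + R (((lh : ℂ) - l) • g) := hG _
    simp only [Submodule.coe_add, map_add, map_sub, ← hu₁, ← hu₂, h₃, hGhat_apply]
    abel
  have hAstar : Astar R B l ψ = ((a₁ + a₂ + a₃ : T.domain) : F) :=
    astar_eq hkerG hranG ⟨_, hψ.symm⟩
  have hmem : Astar R B l ψ ∈ T.domain := hAstar ▸ (a₁ + a₂ + a₃).2
  refine ⟨⟨⟨_, _, hψ.symm⟩, hmem⟩, fun hA => ?_, fun h0 => ?_⟩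
  · have hsub : (⟨Astar R B l ψ, hA⟩ : T.domain) = a₁ + a₂ + a₃ := Subtype.ext hAstar
    have hB : B (u₁ + u₂ - ((lh : ℂ) - l) • g) + T (a₁ + a₂ + a₃) = φ := by
      rw [map_sub, map_add, map_smul, LinearPMap.map_add, LinearPMap.map_add]
      linear_combination (norm := module) hs₁ + hs₂ + hKφ
    rw [SxFun, Azero, hsub, hAstar, hψ, hinv_apply hinj, hB, hH₁]
    rw [hH₂] at hQφ
    linear_combination (norm := module) ((lh : ℂ) - l) • hGhat_apply + hQφ
  · have heq : ψ = Astar R B l ψ := sub_eq_zero.mp h0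
    have hψ' : ψ = ((a₁ + a₂ + a₃ : T.domain) : F) := heq.trans hAstar
    refine ⟨heq ▸ hmem, ?_⟩
    nth_rewrite 2 [hψ']
    exact ⟨_, hψ.symm⟩
end
end
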